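/- arXiv:2205.08612 — 2 statements merged into one kernel-verified Lean document; each statement's English description precedes it below -/
import Mathlib

section
/- Let Ω ⊂ ℝⁿ be a bounded open set, u : Ω → ℝ bounded and lower semicontinuous, q ≥ 2 and ε > 0. Suppose u_ε is Fréchet differentiable at a point x ∈ Ω_{r(ε)} with gradient Du_ε(x). Then for every y ∈ Y_ε(x) one has ( |x − y| / ε )^{q−1} ≤ |Du_ε(x)|. -/
open MeasureTheory Metric Set Filter Asymptotics
open scoped RealInnerProductSpace NNReal Topology

noncomputable section

abbrev En (n : ℕ) := EuclideanSpace ℝ (Fin n)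

/-- The nondivergence-form `p(·)`-Laplacian `-Δ_{p(·)} φ` at `x`. -/
noncomputable def negPLap {n : ℕ} (p φ : En n → ℝ) (x : En n) : ℝ :=
  -(‖gradient φ x‖ ^ (p x - 2) *
      LinearMap.trace ℝ (En n) (fderiv ℝ (gradient φ) x : En n →ₗ[ℝ] En n))
  - (p x - 2) * ‖gradient φ x‖ ^ (p x - 4) *
      ⟪fderiv ℝ (gradient φ) x (gradient φ x), gradient φ x⟫
  - ‖gradient φ x‖ ^ (p x - 2) * Real.log ‖gradient φ x‖ *
      ⟪gradient p x, gradient φ x⟫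

/-- `u` is a viscosity supersolution of `-Δ_{p(·)} u = 0` on an open set `D`. -/
def IsViscositySupersolution {n : ℕ} (p u : En n → ℝ) (D : Set (En n)) : Prop :=
  ∀ x₀ ∈ D, ∀ φ : En n → ℝ,
    ContDiffAt ℝ 2 φ x₀ → φ x₀ = u x₀ →
    (∀ᶠ x in 𝓝[≠] x₀, φ x < u x) →
    gradient φ x₀ ≠ 0 → 0 ≤ negPLap p φ x₀

/-- The infimal convolution `u_ε` of `u`. -/
noncomputable def infConv {n : ℕ} (u : En n → ℝ) (Ω : Set (En n)) (q ε : ℝ) (x : En n) : ℝ :=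
  sInf ((fun y => u y + ‖x - y‖ ^ q / (q * ε ^ (q - 1))) '' Ω)

/-- `r(ε) = (q ε^{q-1} (M - m))^{1/q}` where `M = sup u`, `m = inf u`. -/
noncomputable def rEps {n : ℕ} (u : En n → ℝ) (Ω : Set (En n)) (q ε : ℝ) : ℝ :=
  (q * ε ^ (q - 1) * (sSup (u '' Ω) - sInf (u '' Ω))) ^ (1 / q)

/-- `Ω_r = {x ∈ Ω : dist(x, ∂Ω) > r}`. -/
def innerSet {n : ℕ} (Ω : Set (En n)) (r : ℝ) : Set (En n) :=
  {x ∈ Ω | r < Metric.infDist x (frontier Ω)}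

/-- The set of minimizers `Y_ε(x)`. -/
def Yset {n : ℕ} (u : En n → ℝ) (Ω : Set (En n)) (q ε : ℝ) (x : En n) : Set (En n) :=
  {y ∈ Ω | infConv u Ω q ε x = u y + ‖x - y‖ ^ q / (q * ε ^ (q - 1))}

/-- `f` is locally Lipschitz on `s`. -/
def LocLipschitzOn {n : ℕ} (f : En n → ℝ) (s : Set (En n)) : Prop :=
  ∀ x ∈ s, ∃ K : ℝ≥0, ∃ t ∈ 𝓝[s] x, LipschitzOnWith K f t

open Classical in
/-- `|Du(x)|^{p(x)-2} ⟨Du(x), Dψ(x)⟩`, taken to be `0` where `Du(x) = 0`. -/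
noncomputable def weakIntegrand {n : ℕ} (p u ψ : En n → ℝ) (x : En n) : ℝ :=
  if gradient u x = 0 then 0
  else ‖gradient u x‖ ^ (p x - 2) * ⟪gradient u x, gradient ψ x⟫


/-- The infimal convolution is bounded by each of its competitors. -/
theorem infConv_le {n : ℕ} {u : En n → ℝ} {Ω : Set (En n)} (hu : BddBelow (u '' Ω))
    {q ε : ℝ} (hq : 0 ≤ q) (hε : 0 ≤ ε) {y : En n} (hy : y ∈ Ω) (z : En n) :
    infConv u Ω q ε z ≤ u y + ‖z - y‖ ^ q / (q * ε ^ (q - 1)) := by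
  obtain ⟨m, hm⟩ := hu
  refine csInf_le ⟨m, ?_⟩ ⟨y, hy, rfl⟩
  rintro _ ⟨w, hw, rfl⟩
  have hpen : 0 ≤ ‖z - w‖ ^ q / (q * ε ^ (q - 1)) := by positivity
  exact (hm ⟨w, hw, rfl⟩).trans (le_add_of_nonneg_right hpen)

/-- The derivative of the infimal convolution at `x` in the direction of a minimizer. -/
theorem inner_gradient_infConv {n : ℕ} {u : En n → ℝ} {Ω : Set (En n)}
    (hu : BddBelow (u '' Ω)) {q ε : ℝ} (hq : 0 < q) (hε : 0 ≤ ε) {x y g : En n}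
    (hg : HasGradientAt (infConv u Ω q ε) g x) (hy : y ∈ Yset u Ω q ε x) :
    ⟪g, x - y⟫ = ‖x - y‖ ^ q / ε ^ (q - 1) := by
  set C := ‖x - y‖ ^ q / (q * ε ^ (q - 1)) with hC
  have hline : HasDerivAt (fun t : ℝ => x + t • (y - x)) (y - x) 0 := by
    simpa using ((hasDerivAt_id (0 : ℝ)).smul_const (y - x)).const_add x
  have hconv : HasDerivAt (fun t : ℝ => infConv u Ω q ε (x + t • (y - x))) ⟪g, y - x⟫ 0 := by
    have hfd : HasFDerivAt (infConv u Ω q ε) (InnerProductSpace.toDual ℝ (En n) g)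
        (x + (0 : ℝ) • (y - x)) := by
      simpa using hg.hasFDerivAt
    exact hfd.comp_hasDerivAt (0 : ℝ) hline
  have hpow : HasDerivAt (fun t : ℝ => (1 - t) ^ q * C) (-q * C) 0 := by
    have hsub : HasDerivAt (fun t : ℝ => 1 - t) (-1) 0 := by
      simpa using (hasDerivAt_id (0 : ℝ)).const_sub 1
    simpa using (hsub.rpow_const (p := q) (Or.inl (by norm_num))).mul_const C
  have hmax : IsLocalMax (fun t : ℝ => infConv u Ω q ε (x + t • (y - x)) - (1 - t) ^ q * C) 0 := by
    filter_upwards [Iio_mem_nhds (zero_lt_one' ℝ)] with t ht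
    have ht' : 0 ≤ 1 - t := sub_nonneg.2 (le_of_lt ht)
    have hle := infConv_le hu hq.le hε hy.1 (x + t • (y - x))
    have hnorm : ‖x + t • (y - x) - y‖ = (1 - t) * ‖x - y‖ := by
      rw [show x + t • (y - x) - y = (1 - t) • (x - y) by module, norm_smul,
        Real.norm_of_nonneg ht']
    rw [hnorm, Real.mul_rpow ht' (norm_nonneg _), mul_div_assoc, ← hC] at hle
    have hmin : infConv u Ω q ε x = u y + C := hy.2
    simp only [zero_smul, add_zero, sub_zero, Real.one_rpow, one_mul]
    linarith
  have hzero := hmax.hasDerivAt_eq_zero (hconv.sub hpow)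
  have hqC : q * C = ‖x - y‖ ^ q / ε ^ (q - 1) := by
    rw [hC, ← mul_div_assoc, mul_div_mul_left _ _ hq.ne']
  rw [← neg_sub y x, inner_neg_right, neg_sub, ← hqC]
  linarith

/-- lower bound on the gradient of `u_ε` in terms of the minimizers. -/
theorem stmt11
    {n : ℕ} (hn : 1 ≤ n)
    (Ω : Set (En n)) (hΩo : IsOpen Ω) (hΩb : Bornology.IsBounded Ω)
    (u : En n → ℝ)
    (hbddA : BddAbove (u '' Ω)) (hbddB : BddBelow (u '' Ω))
    (hlsc : LowerSemicontinuousOn u Ω)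
    (q ε : ℝ) (hq : 2 ≤ q) (hε : 0 < ε)
    (x : En n) (hx : x ∈ innerSet Ω (rEps u Ω q ε))
    (g : En n) (hg : HasGradientAt (infConv u Ω q ε) g x) :
    ∀ y ∈ Yset u Ω q ε x, (‖x - y‖ / ε) ^ (q - 1) ≤ ‖g‖ := by
  intro y hy
  have hinner := inner_gradient_infConv hbddB (by linarith) hε.le hg hy
  rcases (norm_nonneg (x - y)).eq_or_lt with hd | hd
  · rw [← hd, zero_div, Real.zero_rpow (by linarith)]
    exact norm_nonneg g
  · refine le_of_mul_le_mul_right ?_ hd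
    calc (‖x - y‖ / ε) ^ (q - 1) * ‖x - y‖ = ‖x - y‖ ^ q / ε ^ (q - 1) := by
          rw [Real.div_rpow hd.le hε.le, div_mul_eq_mul_div, ← Real.rpow_add_one hd.ne',
            sub_add_cancel]
      _ = ⟪g, x - y⟫ := hinner.symm
      _ ≤ ‖g‖ * ‖x - y‖ := real_inner_le_norm g (x - y)
end
end

section
/- Let n ≥ 1, let 1 < p⁻ ≤ p⁺ < 2, let q > p⁻/(p⁻−1), and let ε > 0, L ≥ 0, κ̂ ≥ 0. Then there exists a constant C ≥ 0 such that for every δ ∈ (0,1], every s ∈ [p⁻, p⁺], every w, z ∈ ℝⁿ with |w| ≤ L and |z| ≤ κ̂, and every symmetric n×n matrix A satisfying ⟨Aξ, ξ⟩ ≤ ((q−1)/ε)|w|^{(q−2)/(q−1)}|ξ|² for all ξ ∈ ℝⁿ, one has −(|w|² + δ)^{(s−2)/2} ( tr(A) + (s−2)⟨Aw, w⟩/(|w|² + δ) ) − (|w|² + δ)^{(s−2)/2} log(|w|² + δ) ⟨z, w⟩ ≥ −C. -/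
open MeasureTheory Metric Set Filter Asymptotics
open scoped RealInnerProductSpace NNReal Topology

noncomputable section

/-- The quadratic form of a linear map with nonnegative quadratic form is bounded by its trace. -/
lemma inner_map_self_le_trace_mul_norm_sq {E : Type*} [NormedAddCommGroup E]
    [InnerProductSpace ℝ E] [FiniteDimensional ℝ E] (B : E →ₗ[ℝ] E)
    (hB : ∀ ξ, 0 ≤ ⟪B ξ, ξ⟫) (w : E) :
    ⟪B w, w⟫ ≤ LinearMap.trace ℝ E B * ‖w‖ ^ 2 := by
  rcases eq_or_ne w 0 with rfl | hw
  · simp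
  have hnorm : ‖w‖ ≠ 0 := norm_ne_zero_iff.mpr hw
  set e : E := ‖w‖⁻¹ • w with he
  have hwe : w = ‖w‖ • e := by rw [he, smul_smul, mul_inv_cancel₀ hnorm, one_smul]
  have hone : ‖e‖ = 1 := by
    rw [he, norm_smul, norm_inv, norm_norm, inv_mul_cancel₀ hnorm]
  have horth : Orthonormal ℝ ((↑) : ({e} : Set E) → E) := by
    classical
    rw [orthonormal_subtype_iff_ite]
    rintro v hv u hu
    rw [mem_singleton_iff] at hv hu
    subst hv hu
    simp [hone]
  obtain ⟨u, b, hu, hb⟩ := horth.exists_orthonormalBasis_extension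
  have heu : e ∈ u := by simpa using hu
  have hle : ⟪B e, e⟫ ≤ LinearMap.trace ℝ E B := by
    rw [LinearMap.trace_eq_sum_inner B b]
    have hterm := Finset.single_le_sum (f := fun i => ⟪b i, B (b i)⟫)
      (fun i _ => by rw [real_inner_comm]; exact hB _) (Finset.mem_univ (⟨e, heu⟩ : u))
    simpa [hb, real_inner_comm] using hterm
  calc ⟪B w, w⟫ = ⟪B e, e⟫ * ‖w‖ ^ 2 := by
        conv_lhs => rw [hwe]
        rw [map_smul, real_inner_smul_left, real_inner_smul_right]
        ring
    _ ≤ _ := by gcongr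

/-- If the quadratic form of `A` is at most `K |ξ|²`, then the regularized trace
`tr A + (s - 2) ⟨A w, w⟩ / r` is at most `K dim E` for `1 ≤ s ≤ 2` and `r ≥ |w|²`. -/
lemma trace_add_mul_inner_div_le {E : Type*} [NormedAddCommGroup E]
    [InnerProductSpace ℝ E] [FiniteDimensional ℝ E] (A : E →ₗ[ℝ] E) {K s r : ℝ} (hK : 0 ≤ K)
    (hA : ∀ ξ, ⟪A ξ, ξ⟫ ≤ K * ‖ξ‖ ^ 2) (hs1 : 1 ≤ s) (hs2 : s ≤ 2) (w : E) (hr : 0 < r)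
    (hwr : ‖w‖ ^ 2 ≤ r) :
    LinearMap.trace ℝ E A + (s - 2) * ⟪A w, w⟫ / r ≤ Module.finrank ℝ E * K := by
  set B : E →ₗ[ℝ] E := K • LinearMap.id - A with hBdef
  have hBin (ξ : E) : ⟪B ξ, ξ⟫ = K * ‖ξ‖ ^ 2 - ⟪A ξ, ξ⟫ := by
    simp [hBdef, inner_sub_left, real_inner_smul_left]
  have hB (ξ : E) : 0 ≤ ⟪B ξ, ξ⟫ := by
    rw [hBin]
    linarith [hA ξ]
  have htr : LinearMap.trace ℝ E B = Module.finrank ℝ E * K - LinearMap.trace ℝ E A := by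
    simp [hBdef, mul_comm]
  have htr0 : 0 ≤ LinearMap.trace ℝ E B := by
    rw [LinearMap.trace_eq_sum_inner B (stdOrthonormalBasis ℝ E)]
    exact Finset.sum_nonneg fun i _ => by rw [real_inner_comm]; exact hB _
  have hquot : ⟪B w, w⟫ / r ≤ LinearMap.trace ℝ E B := by
    rw [div_le_iff₀ hr]
    exact (inner_map_self_le_trace_mul_norm_sq B hB w).trans (by gcongr)
  have hquot0 : 0 ≤ ⟪B w, w⟫ / r := div_nonneg (hB w) hr.le
  have hKr : 0 ≤ K * ‖w‖ ^ 2 / r := by positivity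
  have hsplit : ⟪A w, w⟫ / r = K * ‖w‖ ^ 2 / r - ⟪B w, w⟫ / r := by
    rw [hBin]
    ring
  rw [mul_div_assoc, hsplit]
  nlinarith [mul_nonneg (sub_nonneg.mpr hs2) hKr, mul_nonneg (sub_nonneg.mpr hs1) hquot0]

/-- The function `r ↦ r ^ e |log r|` is bounded on `(0, R]` for `0 < e ≤ 1`. -/
lemma rpow_mul_abs_log_le {r R e : ℝ} (hr : 0 < r) (hrR : r ≤ R) (he : 0 < e) (he1 : e ≤ 1) :
    r ^ e * |Real.log r| ≤ 1 / e + R ^ 2 := by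
  rcases le_or_gt r 1 with h | h
  · have hlt := Real.abs_log_mul_self_rpow_lt r e hr h he
    rw [abs_mul, abs_of_nonneg (Real.rpow_nonneg hr.le e), mul_comm] at hlt
    nlinarith [sq_nonneg R]
  · have hpow : r ^ e ≤ R :=
      (Real.rpow_le_self_of_one_le h.le he1).trans hrR
    have hlog : |Real.log r| ≤ R := by
      rw [abs_of_nonneg (Real.log_nonneg h.le)]
      linarith [Real.log_le_sub_one_of_pos hr]
    have : 0 < 1 / e := by positivity
    nlinarith [mul_le_mul hpow hlog (abs_nonneg _) (hr.le.trans hrR)]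

/-- A power `t ^ a` compensates the singular factor `r ^ ((s - 2) / 2)` when `t² ≤ r` and
`2 - s ≤ a ≤ 1`. -/
lemma rpow_mul_rpow_le_of_sq_le {t r R a s : ℝ} (ht : 0 ≤ t) (hr : 0 < r) (htr : t ^ 2 ≤ r)
    (hrR : r ≤ R) (hR : 1 ≤ R) (ha0 : 0 ≤ a) (ha1 : a ≤ 1) (hs : s ≤ 2) (has : 2 - s ≤ a) :
    r ^ ((s - 2) / 2) * t ^ a ≤ R := by
  have hta : t ^ a ≤ r ^ (a / 2) := by
    calc t ^ a = (t ^ 2) ^ (a / 2) := by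
          rw [← Real.rpow_natCast, ← Real.rpow_mul ht]
          congr 1
          push_cast
          ring
      _ ≤ r ^ (a / 2) := Real.rpow_le_rpow (sq_nonneg t) htr (by linarith)
  calc r ^ ((s - 2) / 2) * t ^ a ≤ r ^ ((s - 2) / 2) * r ^ (a / 2) := by gcongr
    _ = r ^ ((s - 2 + a) / 2) := by
        rw [← Real.rpow_add hr]
        congr 1
        ring
    _ ≤ R ^ ((s - 2 + a) / 2) := Real.rpow_le_rpow hr.le hrR (by linarith)
    _ ≤ R := Real.rpow_le_self_of_one_le hR (by linarith)

/-- uniform lower bound for the `δ`-regularized `p(·)`-Laplacian expression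
in the singular case `1 < p < 2`. -/
theorem stmt18
    {n : ℕ} (hn : 1 ≤ n)
    (pminus pplus q ε L κhat : ℝ)
    (hpm : 1 < pminus) (hpmp : pminus ≤ pplus) (hpp : pplus < 2)
    (hq : pminus / (pminus - 1) < q) (hε : 0 < ε) (hL : 0 ≤ L) (hκ : 0 ≤ κhat) :
    ∃ C : ℝ, 0 ≤ C ∧ ∀ δ : ℝ, 0 < δ → δ ≤ 1 → ∀ s : ℝ, pminus ≤ s → s ≤ pplus →
      ∀ w z : En n, ‖w‖ ≤ L → ‖z‖ ≤ κhat →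
      ∀ A : En n →L[ℝ] En n, IsSelfAdjoint A →
      (∀ ξ : En n, ⟪A ξ, ξ⟫ ≤ ((q - 1) / ε) * ‖w‖ ^ ((q - 2) / (q - 1)) * ‖ξ‖ ^ 2) →
      -C ≤ -((‖w‖ ^ 2 + δ) ^ ((s - 2) / 2) *
              (LinearMap.trace ℝ (En n) (A : En n →ₗ[ℝ] En n) +
                (s - 2) * ⟪A w, w⟫ / (‖w‖ ^ 2 + δ)))
           - (‖w‖ ^ 2 + δ) ^ ((s - 2) / 2) * Real.log (‖w‖ ^ 2 + δ) * ⟪z, w⟫ := by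
  have hpm1 : 0 < pminus - 1 := by linarith
  have hpq : pminus < q * (pminus - 1) := (div_lt_iff₀ hpm1).mp hq
  have hq2 : 2 < q := by nlinarith
  have hq1 : 0 < q - 1 := by linarith
  set a := (q - 2) / (q - 1) with ha
  have ha0 : 0 ≤ a := div_nonneg (by linarith) hq1.le
  have ha1 : a ≤ 1 := by rw [ha, div_le_one hq1]; linarith
  have hap : 2 - pminus ≤ a := by
    rw [ha, le_div_iff₀ hq1]
    nlinarith
  set R := L ^ 2 + 1 with hRdef
  have hR : 1 ≤ R := by nlinarith [sq_nonneg L]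
  set c := (q - 1) / ε with hc
  have hc0 : 0 ≤ c := by positivity
  refine ⟨n * c * R + κhat * (2 / (pminus - 1) + R ^ 2), by positivity, ?_⟩
  intro δ hδ hδ1 s hps hsp w z hw hz A _ hA
  set r := ‖w‖ ^ 2 + δ with hrdef
  have hwr : ‖w‖ ^ 2 ≤ r := by linarith
  have hr : 0 < r := by positivity
  have hrR : r ≤ R := by
    have : ‖w‖ ^ 2 ≤ L ^ 2 := by gcongr
    linarith
  have hrp : 0 ≤ r ^ ((s - 2) / 2) := Real.rpow_nonneg hr.le _
  have htrace := trace_add_mul_inner_div_le (A : En n →ₗ[ℝ] En n) (K := c * ‖w‖ ^ a)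
    (by positivity) hA (by linarith : 1 ≤ s) (by linarith) w hr hwr
  rw [finrank_euclideanSpace_fin] at htrace
  have hpow := rpow_mul_rpow_le_of_sq_le (norm_nonneg w) hr hwr hrR hR ha0 ha1
    (by linarith : s ≤ 2) (by linarith)
  have hdiffusion : r ^ ((s - 2) / 2) * (LinearMap.trace ℝ (En n) (A : En n →ₗ[ℝ] En n) +
      (s - 2) * ⟪A w, w⟫ / r) ≤ n * c * R := by
    calc _ ≤ r ^ ((s - 2) / 2) * (n * (c * ‖w‖ ^ a)) := mul_le_mul_of_nonneg_left htrace hrp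
      _ = n * c * (r ^ ((s - 2) / 2) * ‖w‖ ^ a) := by ring
      _ ≤ n * c * R := by gcongr
  have hlog : r ^ ((s - 2) / 2) * Real.log r * ⟪z, w⟫ ≤
      κhat * (2 / (pminus - 1) + R ^ 2) := by
    have hwsqrt : ‖w‖ ≤ r ^ (1 / 2 : ℝ) := by
      rw [← Real.sqrt_eq_rpow]
      exact Real.le_sqrt_of_sq_le hwr
    have hbound := rpow_mul_abs_log_le (e := (s - 1) / 2) hr hrR (by linarith) (by linarith)
    have hinv : 1 / ((s - 1) / 2) ≤ 2 / (pminus - 1) := by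
      rw [one_div_div]
      gcongr
    calc _ ≤ |r ^ ((s - 2) / 2) * Real.log r * ⟪z, w⟫| := le_abs_self _
      _ = r ^ ((s - 2) / 2) * |Real.log r| * |⟪z, w⟫| := by
          rw [abs_mul, abs_mul, abs_of_nonneg hrp]
      _ ≤ r ^ ((s - 2) / 2) * |Real.log r| * (κhat * r ^ (1 / 2 : ℝ)) := by
          gcongr
          exact (abs_real_inner_le_norm z w).trans (by gcongr)
      _ = κhat * (r ^ ((s - 2) / 2) * r ^ (1 / 2 : ℝ) * |Real.log r|) := by ring
      _ = κhat * (r ^ ((s - 1) / 2) * |Real.log r|) := by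
          rw [← Real.rpow_add hr]
          congr 3
          ring
      _ ≤ κhat * (2 / (pminus - 1) + R ^ 2) := by
          gcongr
          linarith
  linarith
end
end
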